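/- Let Q be a stationary ergodic probability measure on 𝕏^ℤ where the alphabet 𝕏 is finite, and suppose δ⁻_Q > 0. Then Q-almost surely γ⁺_Q ≥ δ⁺_Q − ε_Q and γ⁻_Q ≥ δ⁻_Q − ε_Q. -/

import Mathlib

open MeasureTheory ProbabilityTheory Filter

noncomputable section

/-- The binary positive logarithm `log⁺ x`: `log(x+1)` for `x ≥ 0` and `0` for `x < 0`. -/
def logPlus (x : ℝ) : ℝ := if 0 ≤ x then Real.logb 2 (x + 1) else 0

variable {𝕏 : Type*}

/-- The left shift on two-sided sequences. -/
def shift (ω : ℤ → 𝕏) : ℤ → 𝕏 := fun i => ω (i + 1)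

/-- The block `X_{-n+1}^0` of a two-sided sequence. -/
def blockNeg (n : ℕ) (ω : ℤ → 𝕏) : Fin n → 𝕏 := fun i => ω (-(n : ℤ) + 1 + (i : ℕ))

/-- The block `X_1^n` of a two-sided sequence. -/
def blockPos (n : ℕ) (ω : ℤ → 𝕏) : Fin n → 𝕏 := fun i => ω (1 + (i : ℕ))

/-- The block `X_{-n+1}^n` of a two-sided sequence. -/
def blockBoth (n : ℕ) (ω : ℤ → 𝕏) : Fin (2 * n) → 𝕏 := fun i => ω (-(n : ℤ) + 1 + (i : ℕ))

/-- A code assigns nonnegative values to finite strings. -/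
def CodeNonneg (P : (n : ℕ) → (Fin n → 𝕏) → ℝ) : Prop := ∀ n x, 0 ≤ P n x

/-- A code satisfies the Kraft inequality `∑_{x_1^n} P(x_1^n) ≤ 1`. -/
def CodeKraft (P : (n : ℕ) → (Fin n → 𝕏) → ℝ) : Prop :=
  ∀ n, 1 ≤ n → ∑' x : Fin n → 𝕏, P n x ≤ 1

/-- The pointwise mutual information
`I^P(n) = -log P(X_{-n+1}^0) - log P(X_1^n) + log P(X_{-n+1}^n)` (binary logarithm). -/
def pmi (P : (n : ℕ) → (Fin n → 𝕏) → ℝ) (n : ℕ) (ω : ℤ → 𝕏) : ℝ :=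
  -Real.logb 2 (P n (blockNeg n ω)) - Real.logb 2 (P n (blockPos n ω))
    + Real.logb 2 (P (2 * n) (blockBoth n ω))

/-- The upper random Hilberg exponent `γ⁺_P = limsup_n log⁺ I^P(n) / log n`. -/
def gammaPlus (P : (n : ℕ) → (Fin n → 𝕏) → ℝ) (ω : ℤ → 𝕏) : ℝ :=
  limsup (fun n : ℕ => logPlus (pmi P n ω) / Real.logb 2 n) atTop

/-- The lower random Hilberg exponent `γ⁻_P = liminf_n log⁺ I^P(n) / log n`. -/
def gammaMinus (P : (n : ℕ) → (Fin n → 𝕏) → ℝ) (ω : ℤ → 𝕏) : ℝ :=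
  liminf (fun n : ℕ => logPlus (pmi P n ω) / Real.logb 2 n) atTop

variable [MeasurableSpace 𝕏]

/-- The upper expected Hilberg exponent `δ⁺_P = limsup_n log⁺ E_Q I^P(n) / log n`. -/
def deltaPlus (Q : Measure (ℤ → 𝕏)) (P : (n : ℕ) → (Fin n → 𝕏) → ℝ) : ℝ :=
  limsup (fun n : ℕ => logPlus (∫ ω, pmi P n ω ∂Q) / Real.logb 2 n) atTop

/-- The lower expected Hilberg exponent `δ⁻_P = liminf_n log⁺ E_Q I^P(n) / log n`. -/
def deltaMinus (Q : Measure (ℤ → 𝕏)) (P : (n : ℕ) → (Fin n → 𝕏) → ℝ) : ℝ :=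
  liminf (fun n : ℕ => logPlus (∫ ω, pmi P n ω ∂Q) / Real.logb 2 n) atTop

/-- The measure `Q` regarded as a code: `Q(x_1^n) = Q(X_1^n = x_1^n)`. -/
def measureCode (Q : Measure (ℤ → 𝕏)) : (n : ℕ) → (Fin n → 𝕏) → ℝ :=
  fun n x => (Q {ω | blockPos n ω = x}).toReal

/-- The upper inverse expected Hilberg exponent
`ζ⁺_P = limsup_n log⁺ [E_Q (I^P(n)+B)⁻¹]⁻¹ / log n`, for a constant `B`. -/
def zetaPlus (Q : Measure (ℤ → 𝕏)) (P : (n : ℕ) → (Fin n → 𝕏) → ℝ) (B : ℝ) : ℝ :=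
  limsup (fun n : ℕ => logPlus ((∫ ω, (pmi P n ω + B)⁻¹ ∂Q)⁻¹) / Real.logb 2 n) atTop

/-- The lower inverse expected Hilberg exponent
`ζ⁻_P = liminf_n log⁺ [E_Q (I^P(n)+B)⁻¹]⁻¹ / log n`, for a constant `B`. -/
def zetaMinus (Q : Measure (ℤ → 𝕏)) (P : (n : ℕ) → (Fin n → 𝕏) → ℝ) (B : ℝ) : ℝ :=
  liminf (fun n : ℕ => logPlus ((∫ ω, (pmi P n ω + B)⁻¹ ∂Q)⁻¹) / Real.logb 2 n) atTop

/-- The parameter `ε_P = limsup_n log⁺ [Var_Q I^P(n) / E_Q I^P(n)] / log n`. -/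
def epsilonExp (Q : Measure (ℤ → 𝕏)) (P : (n : ℕ) → (Fin n → 𝕏) → ℝ) : ℝ :=
  limsup (fun n : ℕ =>
    logPlus (variance (pmi P n) Q / ∫ ω, pmi P n ω ∂Q) / Real.logb 2 n) atTop

/-- `I^P` is nearly nondecreasing: for some `C ≥ 0`,
`I^P(n+m) ≥ I^P(n) - 4 log m - C` pointwise for all `n, m ≥ 1`. -/
def NearlyNondecreasing (P : (n : ℕ) → (Fin n → 𝕏) → ℝ) : Prop :=
  ∃ C : ℝ, 0 ≤ C ∧ ∀ n m : ℕ, 1 ≤ n → 1 ≤ m → ∀ ω : ℤ → 𝕏,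
    pmi P n ω - 4 * Real.logb 2 m - C ≤ pmi P (n + m) ω



section FiniteRange

variable {Ω α β γ' δ' : Type*} [MeasurableSpace Ω]

theorem integral_comp_eq_sum [Fintype α] [MeasurableSpace α] [MeasurableSingletonClass α]
    (Q : Measure Ω) [IsFiniteMeasure Q] {f : Ω → α} (hf : Measurable f) (g : α → ℝ) :
    ∫ ω, g (f ω) ∂Q = ∑ x, Q.real (f ⁻¹' {x}) * g x := by
  rw [← integral_map hf.aemeasurable (measurable_of_finite g).aestronglyMeasurable,
    integral_fintype Integrable.of_finite]
  simp [map_measureReal_apply hf (measurableSet_singleton _)]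

theorem memLp_comp_of_finite [Finite α] [MeasurableSpace α] [MeasurableSingletonClass α]
    (Q : Measure Ω) [IsFiniteMeasure Q] {f : Ω → α} (hf : Measurable f) (g : α → ℝ)
    (p : ENNReal) : MemLp (fun ω => g (f ω)) p Q := by
  have := Fintype.ofFinite α
  refine MemLp.of_bound ((measurable_of_finite g).comp hf).aestronglyMeasurable
    (∑ x, ‖g x‖) (ae_of_all _ fun ω => ?_)
  exact Finset.single_le_sum (f := fun x => ‖g x‖) (fun _ _ => norm_nonneg _)
    (Finset.mem_univ (f ω))

theorem sum_measureReal_preimage_singleton [Fintype α] [MeasurableSpace α]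
    [MeasurableSingletonClass α] (Q : Measure Ω) [IsProbabilityMeasure Q] {f : Ω → α}
    (hf : Measurable f) : ∑ x, Q.real (f ⁻¹' {x}) = 1 := by
  simpa using (integral_comp_eq_sum Q hf (fun _ => 1)).symm

theorem ae_measureReal_fiber_pos [Finite α] [MeasurableSpace α] [MeasurableSingletonClass α]
    (Q : Measure Ω) [IsFiniteMeasure Q] (f : Ω → α) :
    ∀ᵐ ω ∂Q, 0 < Q.real (f ⁻¹' {f ω}) := by
  have h : ∀ x : α, ∀ᵐ ω ∂Q, f ω = x → 0 < Q.real (f ⁻¹' {x}) := by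
    intro x
    by_cases hx : Q (f ⁻¹' {x}) = 0
    · filter_upwards [measure_eq_zero_iff_ae_notMem.1 hx] with ω hω h
      exact absurd h hω
    · exact ae_of_all _ fun ω _ => ENNReal.toReal_pos hx (measure_ne_top _ _)
  filter_upwards [ae_all_iff.2 h] with ω hω using hω _ rfl

theorem mul_log_sq_le {p N : ℝ} (hp : 0 ≤ p) (hp1 : p ≤ 1) (hN : 1 ≤ N) :
    p * Real.log p ^ 2 ≤ 4 * Real.log N ^ 2 * p + 8 / N := by
  have hN0 : 0 < N := by linarith
  rcases hp.eq_or_lt with rfl | hp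
  · simp; positivity
  have hlogN := Real.log_nonneg hN
  by_cases h : 1 ≤ p * N
  · have h1 : -Real.log N ≤ Real.log p := by
      have := Real.log_nonneg h
      rw [Real.log_mul hp.ne' hN0.ne'] at this
      linarith
    have h2 := Real.log_nonpos hp.le hp1
    have h3 : Real.log p ^ 2 ≤ Real.log N ^ 2 := by nlinarith
    have : 0 ≤ 8 / N := by positivity
    nlinarith [sq_nonneg (Real.log N)]
  · push Not at h
    have hu : 0 < p * N := by positivity
    have h1 := Real.abs_log_mul_self_lt (√(p * N)) (Real.sqrt_pos.2 hu)
      (Real.sqrt_le_one.2 h.le)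
    rw [Real.log_sqrt hu.le, Real.log_mul hp.ne' hN0.ne'] at h1
    have h2 := (sq_lt_one_iff_abs_lt_one _).2 h1
    rw [mul_pow, Real.sq_sqrt hu.le] at h2
    have h3 : p * (Real.log p + Real.log N) ^ 2 ≤ 4 / N := by
      rw [le_div_iff₀ hN0]; nlinarith
    have h4 : Real.log p ^ 2 ≤ 2 * (Real.log p + Real.log N) ^ 2 + 2 * Real.log N ^ 2 := by
      nlinarith [sq_nonneg (Real.log p + 2 * Real.log N)]
    have h5 : 8 / N = 2 * (4 / N) := by ring
    rw [h5]
    nlinarith [mul_le_mul_of_nonneg_left h4 hp.le, sq_nonneg (Real.log N)]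

/-- The second moment of the pointwise entropy of a variable with finitely many values. -/
theorem integral_log_fiber_sq_le [Fintype α] [MeasurableSpace α] [MeasurableSingletonClass α]
    (Q : Measure Ω) [IsProbabilityMeasure Q] {f : Ω → α} (hf : Measurable f) :
    ∫ ω, Real.log (Q.real (f ⁻¹' {f ω})) ^ 2 ∂Q ≤ 4 * Real.log (Fintype.card α) ^ 2 + 8 := by
  have : Nonempty α := (nonempty_of_isProbabilityMeasure Q).map f
  have hN : (1 : ℝ) ≤ Fintype.card α := by exact_mod_cast Fintype.card_pos
  rw [integral_comp_eq_sum Q hf (fun x => Real.log (Q.real (f ⁻¹' {x})) ^ 2)]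
  calc _ ≤ ∑ x, (4 * Real.log (Fintype.card α) ^ 2 * Q.real (f ⁻¹' {x})
            + 8 / Fintype.card α) :=
        Finset.sum_le_sum fun x _ => mul_log_sq_le measureReal_nonneg measureReal_le_one hN
    _ = _ := by
      rw [Finset.sum_add_distrib, ← Finset.mul_sum, sum_measureReal_preimage_singleton Q hf]
      simp
      field_simp

theorem sum_measureReal_inter_preimage [Fintype α] [MeasurableSpace α]
    [MeasurableSingletonClass α] (Q : Measure Ω) [IsFiniteMeasure Q] {f : Ω → α}
    (hf : Measurable f) (s : Set Ω) :
    ∑ x, Q.real (f ⁻¹' {x} ∩ s) = Q.real s := by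
  have h := integral_comp_eq_sum (Q.restrict s) hf (fun _ => 1)
  simp only [integral_const, smul_eq_mul, mul_one, measureReal_restrict_apply_univ] at h
  rw [h]
  exact Finset.sum_congr rfl fun x _ =>
    (measureReal_restrict_apply (hf (measurableSet_singleton x))).symm

/-- The expected ratio of the exponentiated pointwise mutual informations
of `(B, C)` and `((A, B), (C, D))` is at most one. -/
theorem integral_pmi_ratio_le_one
    [Fintype α] [MeasurableSpace α] [MeasurableSingletonClass α]
    [Fintype β] [MeasurableSpace β] [MeasurableSingletonClass β]
    [Fintype γ'] [MeasurableSpace γ'] [MeasurableSingletonClass γ']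
    [Fintype δ'] [MeasurableSpace δ'] [MeasurableSingletonClass δ']
    (Q : Measure Ω) [IsProbabilityMeasure Q] {A : Ω → α} {B : Ω → β} {C : Ω → γ'} {D : Ω → δ'}
    (hA : Measurable A) (hB : Measurable B) (hC : Measurable C) (hD : Measurable D) :
    Integrable (fun ω =>
      Q.real (B ⁻¹' {B ω} ∩ C ⁻¹' {C ω}) * (Q.real (A ⁻¹' {A ω} ∩ B ⁻¹' {B ω}) /
        Q.real (B ⁻¹' {B ω})) * (Q.real (D ⁻¹' {D ω} ∩ C ⁻¹' {C ω}) / Q.real (C ⁻¹' {C ω})) /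
        Q.real ((A ⁻¹' {A ω} ∩ B ⁻¹' {B ω}) ∩ (D ⁻¹' {D ω} ∩ C ⁻¹' {C ω}))) Q ∧
    ∫ ω, Q.real (B ⁻¹' {B ω} ∩ C ⁻¹' {C ω}) * (Q.real (A ⁻¹' {A ω} ∩ B ⁻¹' {B ω}) /
        Q.real (B ⁻¹' {B ω})) * (Q.real (D ⁻¹' {D ω} ∩ C ⁻¹' {C ω}) / Q.real (C ⁻¹' {C ω})) /
        Q.real ((A ⁻¹' {A ω} ∩ B ⁻¹' {B ω}) ∩ (D ⁻¹' {D ω} ∩ C ⁻¹' {C ω})) ∂Q ≤ 1 := by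
  set f : Ω → (β × γ') × (α × δ') := fun ω => ((B ω, C ω), (A ω, D ω)) with hf_def
  have hf : Measurable f := (hB.prodMk hC).prodMk (hA.prodMk hD)
  set h : (β × γ') × (α × δ') → ℝ := fun x =>
    Q.real (B ⁻¹' {x.1.1} ∩ C ⁻¹' {x.1.2}) *
      (Q.real (A ⁻¹' {x.2.1} ∩ B ⁻¹' {x.1.1}) / Q.real (B ⁻¹' {x.1.1})) *
      (Q.real (D ⁻¹' {x.2.2} ∩ C ⁻¹' {x.1.2}) / Q.real (C ⁻¹' {x.1.2})) with hh
  have hh0 : ∀ x, 0 ≤ h x := fun x => by simp only [hh]; positivity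
  set g : (β × γ') × (α × δ') → ℝ := fun x => h x /
      Q.real ((A ⁻¹' {x.2.1} ∩ B ⁻¹' {x.1.1}) ∩ (D ⁻¹' {x.2.2} ∩ C ⁻¹' {x.1.2})) with hg
  refine ⟨memLp_one_iff_integrable.1 (memLp_comp_of_finite Q hf g 1), ?_⟩
  change ∫ ω, g (f ω) ∂Q ≤ 1
  rw [integral_comp_eq_sum Q hf g]
  have hpre : ∀ x : (β × γ') × (α × δ'), f ⁻¹' {x} =
      (A ⁻¹' {x.2.1} ∩ B ⁻¹' {x.1.1}) ∩ (D ⁻¹' {x.2.2} ∩ C ⁻¹' {x.1.2}) := by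
    rintro ⟨⟨b, c⟩, a, d⟩
    ext ω
    simp [hf_def]
    tauto
  calc _ ≤ ∑ x, h x := by
        refine Finset.sum_le_sum fun x _ => ?_
        rw [hpre, hg]
        rcases eq_or_ne (Q.real ((A ⁻¹' {x.2.1} ∩ B ⁻¹' {x.1.1}) ∩
          (D ⁻¹' {x.2.2} ∩ C ⁻¹' {x.1.2}))) 0 with h0 | h0
        · rw [h0, zero_mul]; exact hh0 x
        · exact (mul_div_cancel₀ _ h0).le
    _ = ∑ y : β × γ', Q.real (B ⁻¹' {y.1} ∩ C ⁻¹' {y.2}) *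
          ((∑ a, Q.real (A ⁻¹' {a} ∩ B ⁻¹' {y.1}) / Q.real (B ⁻¹' {y.1})) *
          ∑ d, Q.real (D ⁻¹' {d} ∩ C ⁻¹' {y.2}) / Q.real (C ⁻¹' {y.2})) := by
        rw [Fintype.sum_prod_type]
        refine Finset.sum_congr rfl fun y _ => ?_
        rw [Finset.sum_mul_sum, ← Fintype.sum_prod_type', Finset.mul_sum]
        exact Finset.sum_congr rfl fun z _ => by simp only [hh]; ring
    _ ≤ ∑ y : β × γ', Q.real (B ⁻¹' {y.1} ∩ C ⁻¹' {y.2}) := by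
        refine Finset.sum_le_sum fun y _ => ?_
        rw [← Finset.sum_div, ← Finset.sum_div,
          sum_measureReal_inter_preimage Q hA,
          sum_measureReal_inter_preimage Q hD]
        exact mul_le_of_le_one_right measureReal_nonneg
          (mul_le_one₀ (div_self_le_one _) (by positivity) (div_self_le_one _))
    _ = 1 := by
        rw [← sum_measureReal_preimage_singleton Q (hB.prodMk hC)]
        refine Finset.sum_congr rfl fun y _ => ?_
        congr 1
        ext ω
        simp [Prod.ext_iff]

end FiniteRange

section GrowthExponent

theorem logPlus_nonneg (x : ℝ) : 0 ≤ logPlus x := by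
  unfold logPlus
  split_ifs with h
  · exact Real.logb_nonneg one_lt_two (by linarith)
  · exact le_rfl

theorem logPlus_div_nonneg (x : ℝ) (n : ℕ) : 0 ≤ logPlus x / Real.logb 2 n := by
  refine div_nonneg (logPlus_nonneg x) ?_
  rcases n.eq_zero_or_pos with rfl | hn
  · simp
  · exact Real.logb_nonneg one_lt_two (by exact_mod_cast hn)

theorem logb_two_natCast_pos {n : ℕ} (hn : 2 ≤ n) : 0 < Real.logb 2 n :=
  Real.logb_pos one_lt_two (by exact_mod_cast hn)

theorem mul_logb_two_eq {n : ℕ} (hn : 2 ≤ n) (c : ℝ) :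
    c * Real.logb 2 n = Real.logb 2 ((n : ℝ) ^ c) := by
  rw [Real.logb_rpow_eq_mul_logb_of_pos (by exact_mod_cast (by lia : 0 < n))]

theorem le_logPlus_div {n : ℕ} (hn : 2 ≤ n) {x c : ℝ} (hx : 0 ≤ x) (h : (n : ℝ) ^ c ≤ x + 1) :
    c ≤ logPlus x / Real.logb 2 n := by
  have hn0 : (0 : ℝ) < n := by exact_mod_cast (by lia : 0 < n)
  rw [le_div_iff₀ (logb_two_natCast_pos hn), mul_logb_two_eq hn, logPlus, if_pos hx]
  exact Real.logb_le_logb_of_le one_lt_two (Real.rpow_pos_of_pos hn0 _) h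

theorem logPlus_div_le {n : ℕ} (hn : 2 ≤ n) {x c : ℝ} (hc : 0 ≤ c) (h : x + 1 ≤ (n : ℝ) ^ c) :
    logPlus x / Real.logb 2 n ≤ c := by
  rw [div_le_iff₀ (logb_two_natCast_pos hn), logPlus]
  split_ifs with hx
  · rw [mul_logb_two_eq hn]
    exact Real.logb_le_logb_of_le one_lt_two (by linarith) h
  · exact mul_nonneg hc (logb_two_natCast_pos hn).le

theorem rpow_lt_of_lt_logPlus_div {n : ℕ} (hn : 2 ≤ n) {x c : ℝ} (hc : 0 ≤ c)
    (h : c < logPlus x / Real.logb 2 n) : (n : ℝ) ^ c < x + 1 := by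
  by_contra! h'
  exact absurd (logPlus_div_le hn hc h') (not_le.2 h)

theorem lt_rpow_of_logPlus_div_lt {n : ℕ} (hn : 2 ≤ n) {x c : ℝ}
    (h : logPlus x / Real.logb 2 n < c) : x + 1 < (n : ℝ) ^ c := by
  have hc : 0 < c := (logPlus_div_nonneg x n).trans_lt h
  have hn1 : (1 : ℝ) < n := by exact_mod_cast (by lia : 1 < n)
  by_contra! h'
  have : 0 ≤ x := by linarith [Real.one_le_rpow hn1.le hc.le]
  exact absurd (le_logPlus_div hn this h') (not_le.2 h)

theorem isBoundedUnder_ge_logPlus_div (x : ℕ → ℝ) :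
    atTop.IsBoundedUnder (· ≥ ·) fun n : ℕ => logPlus (x n) / Real.logb 2 n :=
  isBoundedUnder_of ⟨0, fun n => logPlus_div_nonneg _ n⟩

theorem isBoundedUnder_le_logPlus_div {x : ℕ → ℝ} {c : ℝ} (hc : 0 ≤ c)
    (h : ∀ᶠ n : ℕ in atTop, x n + 1 ≤ (n : ℝ) ^ c) :
    atTop.IsBoundedUnder (· ≤ ·) fun n : ℕ => logPlus (x n) / Real.logb 2 n :=
  isBoundedUnder_of_eventually_le (a := c) <| by
    filter_upwards [h, eventually_ge_atTop 2] with n hn h2 using logPlus_div_le h2 hc hn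

theorem tendsto_natCast_rpow_atTop {c : ℝ} (hc : 0 < c) :
    Tendsto (fun n : ℕ => (n : ℝ) ^ c) atTop atTop :=
  (tendsto_rpow_atTop hc).comp tendsto_natCast_atTop_atTop

theorem isLittleO_rpow_rpow_atTop {c d : ℝ} (h : d < c) :
    (fun x : ℝ => x ^ d) =o[atTop] fun x : ℝ => x ^ c := by
  rw [Asymptotics.isLittleO_iff_tendsto' (by
    filter_upwards [eventually_gt_atTop 0] with x hx h0
    exact absurd h0 (Real.rpow_pos_of_pos hx _).ne')]
  refine (tendsto_rpow_neg_atTop (sub_pos.2 h)).congr' ?_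
  filter_upwards [eventually_gt_atTop 0] with x hx
  rw [← Real.rpow_sub hx, neg_sub]

/-- A power dominates any smaller power up to constants and logarithms. -/
theorem eventually_rpow_le_div_two_rpow_sub_log {c d : ℝ} (hc : 0 < c) (hd : d < c) :
    ∀ᶠ n : ℕ in atTop, (n : ℝ) ^ d ≤ (((n : ℝ) / 2) ^ c - 1) / 2 - 2 * Real.logb 2 n := by
  have h1 : (fun x : ℝ => x ^ d) =o[atTop] fun x : ℝ => x ^ c := isLittleO_rpow_rpow_atTop hd
  have h2 : (fun x : ℝ => Real.log x) =o[atTop] fun x : ℝ => x ^ c := isLittleO_log_rpow_atTop hc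
  have h3 : (fun x : ℝ => (1 : ℝ)) =o[atTop] fun x : ℝ => x ^ c := by
    simpa using isLittleO_rpow_rpow_atTop hc
  have h4 := (h1.add (h3.const_mul_left (1 / 2))).add (h2.const_mul_left (2 / Real.log 2))
  have h5 := h4.def (c := (1 / 2) ^ c / 2) (by positivity)
  have h6 := tendsto_natCast_atTop_atTop (R := ℝ) |>.eventually h5
  filter_upwards [h6] with n hn
  have hn0 : (0 : ℝ) ≤ (n : ℝ) ^ c := by positivity
  rw [Real.norm_of_nonneg hn0] at hn
  have := (le_abs_self _).trans hn
  rw [div_eq_mul_one_div (n : ℝ) 2, Real.mul_rpow (by positivity) (by positivity), Real.logb]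
  have e : 2 * (Real.log n / Real.log 2) = 2 / Real.log 2 * Real.log n := by ring
  rw [e]
  linarith

variable {Ω : Type*} [MeasurableSpace Ω] {Q : Measure Ω} [IsProbabilityMeasure Q]

theorem ae_eventually_notMem_of_measureReal_le {s : ℕ → Set Ω} {b : ℕ → ℝ} (hb : Summable b)
    (hs : ∀ᶠ n in atTop, Q.real (s n) ≤ b n) : ∀ᵐ ω ∂Q, ∀ᶠ n in atTop, ω ∉ s n := by
  refine ae_eventually_notMem ?_
  have hsum : Summable fun n => Q.real (s n) := by
    refine summable_of_isBigO_nat hb (Asymptotics.IsBigO.of_bound 1 ?_)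
    filter_upwards [hs] with n hn
    rw [Real.norm_of_nonneg measureReal_nonneg, one_mul]
    exact hn.trans (le_abs_self _)
  have : ∀ n, Q (s n) = ENNReal.ofReal (Q.real (s n)) := fun n => by simp
  simp_rw [this]
  exact hsum.tsum_ofReal_ne_top

theorem ae_frequently_notMem_of_frequently_measureReal_le {s : ℕ → Set Ω} {b : ℕ → ℝ}
    {p : ℕ → Prop} (hb : Tendsto b atTop (nhds 0))
    (hs : ∃ᶠ n in atTop, p n ∧ Q.real (s n) ≤ b n) :
    ∀ᵐ ω ∂Q, ∃ᶠ n in atTop, p n ∧ ω ∉ s n := by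
  have h : ∀ N : ℕ, ∀ᵐ ω ∂Q, ∃ n ≥ N, p n ∧ ω ∉ s n := by
    intro N
    rw [ae_iff, ← measureReal_eq_zero_iff]
    refine le_antisymm (le_of_forall_pos_lt_add fun ε hε => ?_) measureReal_nonneg
    obtain ⟨n, ⟨hp, hn⟩, hbn, hN⟩ :=
      (hs.and_eventually ((hb.eventually_lt_const hε).and (eventually_ge_atTop N))).exists
    rw [zero_add]
    refine (measureReal_mono fun ω hω => ?_).trans_lt (hn.trans_lt hbn)
    by_contra h'
    exact hω ⟨n, hN, hp, h'⟩
  filter_upwards [ae_all_iff.2 h] with ω hω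
  exact frequently_atTop.2 hω

theorem measureReal_le_half_expectation {X : Ω → ℝ} (hX : MemLp X 2 Q)
    (hpos : 0 < ∫ ω, X ω ∂Q) :
    Q.real {ω | X ω ≤ (∫ ω, X ω ∂Q) / 2} ≤
      4 * (variance X Q / ∫ ω, X ω ∂Q) / ∫ ω, X ω ∂Q := by
  have h := meas_ge_le_variance_div_sq hX (half_pos hpos)
  have h' : Q.real {ω | (∫ ω, X ω ∂Q) / 2 ≤ |X ω - ∫ ω, X ω ∂Q|} ≤
      variance X Q / ((∫ ω, X ω ∂Q) / 2) ^ 2 :=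
    ENNReal.toReal_le_of_le_ofReal (div_nonneg (variance_nonneg _ _) (sq_nonneg _)) h
  refine (measureReal_mono fun ω (hω : X ω ≤ _) => ?_).trans (h'.trans_eq ?_)
  · change _ ≤ |X ω - _|
    rw [abs_sub_comm]
    exact (by linarith : _ ≤ (∫ ω, X ω ∂Q) - X ω).trans (le_abs_self _)
  · field_simp
    norm_num

/-- Chebyshev bound in terms of growth exponents of the mean and of the variance-to-mean ratio. -/
theorem measureReal_le_half_expectation_of_exponents {X : Ω → ℝ} (hX : MemLp X 2 Q) {n : ℕ}
    {b c : ℝ} (hn : 2 ≤ (n : ℝ) ^ c) (hc : (n : ℝ) ^ c < (∫ ω, X ω ∂Q) + 1)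
    (hb : variance X Q / (∫ ω, X ω ∂Q) + 1 < (n : ℝ) ^ b) (hn0 : 0 < n) :
    Q.real {ω | X ω ≤ (∫ ω, X ω ∂Q) / 2} ≤ 8 * (n : ℝ) ^ (b - c) := by
  have hpos : 0 < ∫ ω, X ω ∂Q := by linarith
  refine (measureReal_le_half_expectation hX hpos).trans ?_
  rw [Real.rpow_sub (by exact_mod_cast hn0), div_le_iff₀ hpos]
  have h0 : 0 ≤ (n : ℝ) ^ b := by positivity
  have h1 : 8 * ((n : ℝ) ^ b / (n : ℝ) ^ c) * ((n : ℝ) ^ c / 2) = 4 * (n : ℝ) ^ b := by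
    field_simp; norm_num
  have h2 : 8 * ((n : ℝ) ^ b / (n : ℝ) ^ c) * ((n : ℝ) ^ c / 2) ≤
      8 * ((n : ℝ) ^ b / (n : ℝ) ^ c) * ∫ ω, X ω ∂Q :=
    mul_le_mul_of_nonneg_left (by linarith) (by positivity)
  linarith

/-- Almost sure lower bounds on growth exponents of a sequence of random variables whose second
moments grow at most quadratically and which is nearly nondecreasing along dyadic scales. -/
theorem ae_growth_exponents_lower_bound {I : ℕ → Ω → ℝ} (hI : ∀ n, MemLp (I n) 2 Q) {K : ℝ}
    (hK : ∀ n ≥ 1, ∫ ω, I n ω ^ 2 ∂Q ≤ K * (n : ℝ) ^ 2)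
    (hmono : ∀ᵐ ω ∂Q, ∀ᶠ n : ℕ in atTop, I (2 ^ Nat.log 2 n) ω - 2 * Real.logb 2 n ≤ I n ω)
    {δp δm ε : ℝ}
    (hδp : δp = limsup (fun n : ℕ => logPlus (∫ ω, I n ω ∂Q) / Real.logb 2 n) atTop)
    (hδm : δm = liminf (fun n : ℕ => logPlus (∫ ω, I n ω ∂Q) / Real.logb 2 n) atTop)
    (hε : ε = limsup (fun n : ℕ =>
      logPlus (variance (I n) Q / ∫ ω, I n ω ∂Q) / Real.logb 2 n) atTop)
    (hpos : 0 < δm) :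
    ∀ᵐ ω ∂Q,
      δp - ε ≤ limsup (fun n : ℕ => logPlus (I n ω) / Real.logb 2 n) atTop ∧
      δm - ε ≤ liminf (fun n : ℕ => logPlus (I n ω) / Real.logb 2 n) atTop := by
  have hE : ∀ c < δm, 0 ≤ c → ∀ᶠ n : ℕ in atTop, (n : ℝ) ^ c < (∫ ω, I n ω ∂Q) + 1 := by
    intro c hc hc0
    rw [hδm] at hc
    filter_upwards [eventually_lt_of_lt_liminf hc (isBoundedUnder_ge_logPlus_div _),
      eventually_ge_atTop 2] with n hn h2 using rpow_lt_of_lt_logPlus_div h2 hc0 hn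
  have hF : ∀ c < δp, 0 ≤ c → ∃ᶠ n : ℕ in atTop, (n : ℝ) ^ c < (∫ ω, I n ω ∂Q) + 1 := by
    intro c hc hc0
    rw [hδp] at hc
    refine ((frequently_lt_of_lt_limsup (isBoundedUnder_ge_logPlus_div _).isCoboundedUnder_le
      hc).and_eventually (eventually_ge_atTop 2)).mono ?_
    rintro n ⟨hn, h2⟩
    exact rpow_lt_of_lt_logPlus_div h2 hc0 hn
  have hquad : ∀ᶠ n : ℕ in atTop, K * (n : ℝ) ^ 2 + 1 ≤ (n : ℝ) ^ (4 : ℝ) := by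
    have h := tendsto_natCast_atTop_atTop (R := ℝ)
    filter_upwards [h.eventually_ge_atTop (|K| + 1)] with n hn
    have hK' := le_abs_self K
    have hK0 := abs_nonneg K
    have : (n : ℝ) ^ (4 : ℝ) = (n : ℝ) ^ 4 := by exact_mod_cast Real.rpow_natCast (n : ℝ) 4
    rw [this]
    have h1 : K + 1 ≤ (n : ℝ) ^ 2 := by nlinarith
    nlinarith [mul_le_mul_of_nonneg_right h1 (sq_nonneg (n : ℝ))]
  have hvarbdd : atTop.IsBoundedUnder (· ≤ ·) fun n : ℕ =>
      logPlus (variance (I n) Q / ∫ ω, I n ω ∂Q) / Real.logb 2 n := by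
    refine isBoundedUnder_le_logPlus_div (c := 4) (by norm_num) ?_
    filter_upwards [hE (δm / 2) (by linarith) (by linarith), hquad, eventually_ge_atTop 1,
      (tendsto_natCast_rpow_atTop (half_pos hpos)).eventually_ge_atTop 2] with n h1 h2 h3 h4
    have hv : variance (I n) Q ≤ K * (n : ℝ) ^ 2 := by
      refine le_trans ?_ (hK n h3)
      exact variance_le_expectation_sq (hI n).aestronglyMeasurable
    have : variance (I n) Q / ∫ ω, I n ω ∂Q ≤ variance (I n) Q :=
      div_le_self (variance_nonneg _ _) (by linarith)
    linarith
  have hε0 : 0 ≤ ε := by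
    rw [hε]
    exact le_limsup_of_frequently_le
      (Frequently.of_forall fun n => logPlus_div_nonneg _ n) hvarbdd
  have hV : ∀ b > ε, ∀ᶠ n : ℕ in atTop,
      variance (I n) Q / (∫ ω, I n ω ∂Q) + 1 < (n : ℝ) ^ b := by
    intro b hb
    rw [hε] at hb
    filter_upwards [eventually_lt_of_limsup_lt hb hvarbdd,
      eventually_ge_atTop 2] with n hn h2 using lt_rpow_of_logPlus_div_lt h2 hn
  have hbdd : ∀ᵐ ω ∂Q, atTop.IsBoundedUnder (· ≤ ·) fun n : ℕ =>
      logPlus (I n ω) / Real.logb 2 n := by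
    have h := ae_eventually_notMem_of_measureReal_le (Q := Q)
      (s := fun n => {ω | (n : ℝ) ^ 4 ≤ I n ω ^ 2})
      ((Real.summable_one_div_nat_pow.2 one_lt_two).mul_left K) (by
        filter_upwards [eventually_ge_atTop 1] with n hn
        have hn0 : (0 : ℝ) < n := by exact_mod_cast hn
        have h1 := mul_meas_ge_le_integral_of_nonneg (ae_of_all Q fun ω => sq_nonneg (I n ω))
          (hI n).integrable_sq ((n : ℝ) ^ 4)
        have h2 := h1.trans (hK n hn)
        rw [mul_one_div, le_div_iff₀ (by positivity)]
        have h3 : 0 < (n : ℝ) ^ 2 := by positivity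
        refine le_of_mul_le_mul_right ?_ h3
        linarith)
    filter_upwards [h] with ω hω
    refine isBoundedUnder_le_logPlus_div (c := 3) (by norm_num) ?_
    filter_upwards [hω, eventually_ge_atTop 2] with n hn h2
    simp only [not_le] at hn
    have h2' : (2 : ℝ) ≤ n := by exact_mod_cast h2
    have h3 : I n ω < (n : ℝ) ^ 2 := lt_of_pow_lt_pow_left₀ 2 (by positivity)
      (hn.trans_eq (by ring))
    have : (n : ℝ) ^ (3 : ℝ) = (n : ℝ) ^ 3 := by exact_mod_cast Real.rpow_natCast (n : ℝ) 3
    rw [this]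
    nlinarith
  have hplus : ∀ q : ℚ, ε < δp → q < δp → ∀ᵐ ω ∂Q, ∃ᶠ n : ℕ in atTop,
      (q : ℝ) ≤ logPlus (I n ω) / Real.logb 2 n := by
    intro q hεδ hq
    obtain ⟨c, hc1, hc2⟩ := exists_between (max_lt hεδ hq)
    rw [max_lt_iff] at hc1
    obtain ⟨b, hb1, hb2⟩ := exists_between hc1.1
    have hc0 : 0 < c := hε0.trans_lt hc1.1
    have hlim : Tendsto (fun n : ℕ => 8 * (n : ℝ) ^ (b - c)) atTop (nhds 0) := by
      have := ((tendsto_rpow_neg_atTop (sub_pos.2 hb2)).comp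
        (tendsto_natCast_atTop_atTop (R := ℝ))).const_mul 8
      simpa [Function.comp_def] using this
    have h := ae_frequently_notMem_of_frequently_measureReal_le (Q := Q)
      (s := fun n => {ω | I n ω ≤ (∫ ω, I n ω ∂Q) / 2})
      (p := fun n => (n : ℝ) ^ c < (∫ ω, I n ω ∂Q) + 1) hlim (by
        refine ((hF c hc2 hc0.le).and_eventually ((hV b hb1).and ((eventually_ge_atTop 1).and
          ((tendsto_natCast_rpow_atTop hc0).eventually_ge_atTop 2)))).mono ?_
        rintro n ⟨h1, h2, h3, h4⟩
        exact ⟨h1, measureReal_le_half_expectation_of_exponents (hI n) h4 h1 h2 h3⟩)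
    filter_upwards [h] with ω hω
    refine (hω.and_eventually ((eventually_rpow_le_div_two_rpow_sub_log hc0 hc1.2).and
      (eventually_ge_atTop 2))).mono ?_
    rintro n ⟨⟨h1, h2⟩, h3, h4⟩
    simp only [not_le] at h2
    have h5 : ((n : ℝ) / 2) ^ c ≤ (n : ℝ) ^ c :=
      Real.rpow_le_rpow (by positivity) (half_le_self (by positivity)) hc0.le
    have h6 := (logb_two_natCast_pos h4).le
    have h7 : (0 : ℝ) ≤ (n : ℝ) ^ (q : ℝ) := by positivity
    exact le_logPlus_div h4 (by linarith) (by linarith)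
  have hminus : ∀ q : ℚ, ε < δm → q < δm → ∀ᵐ ω ∂Q, ∀ᶠ n : ℕ in atTop,
      (q : ℝ) ≤ logPlus (I n ω) / Real.logb 2 n := by
    intro q hεδ hq
    obtain ⟨c, hc1, hc2⟩ := exists_between (max_lt hεδ hq)
    rw [max_lt_iff] at hc1
    obtain ⟨b, hb1, hb2⟩ := exists_between hc1.1
    have hc0 : 0 < c := hε0.trans_lt hc1.1
    have hdyadic : Tendsto (fun k : ℕ => 2 ^ k) atTop (atTop : Filter ℕ) :=
      tendsto_pow_atTop_atTop_of_one_lt one_lt_two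
    have hsum : Summable fun k : ℕ => 8 * (((2 ^ k : ℕ) : ℝ)) ^ (b - c) := by
      refine Summable.mul_left 8 ?_
      have : ∀ k : ℕ, (((2 ^ k : ℕ) : ℝ)) ^ (b - c) = ((2 : ℝ) ^ (b - c)) ^ k := by
        intro k
        rw [Nat.cast_pow, Nat.cast_ofNat, Real.rpow_pow_comm zero_le_two]
      simp_rw [this]
      exact summable_geometric_of_lt_one (by positivity)
        (Real.rpow_lt_one_of_one_lt_of_neg one_lt_two (by linarith))
    have h := ae_eventually_notMem_of_measureReal_le (Q := Q)
      (s := fun k => {ω | I (2 ^ k) ω ≤ (∫ ω, I (2 ^ k) ω ∂Q) / 2}) hsum (by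
        filter_upwards [hdyadic.eventually (hE c hc2 hc0.le), hdyadic.eventually (hV b hb1),
          hdyadic.eventually ((tendsto_natCast_rpow_atTop hc0).eventually_ge_atTop 2)]
          with k h1 h2 h3
        exact measureReal_le_half_expectation_of_exponents (hI _) h3 h1 h2 (by positivity))
    have hlog : Tendsto (fun n : ℕ => Nat.log 2 n) atTop atTop :=
      tendsto_atTop.2 fun k => by
        filter_upwards [eventually_ge_atTop (2 ^ k)] with n hn
        exact Nat.le_log_of_pow_le one_lt_two hn
    filter_upwards [h, hmono] with ω hω hm
    filter_upwards [hlog.eventually hω, hm, hlog.eventually (hdyadic.eventually (hE c hc2 hc0.le)),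
      eventually_rpow_le_div_two_rpow_sub_log hc0 hc1.2, eventually_ge_atTop 2]
      with n h1 h2 h3 h4 h5
    simp only [not_le] at h1
    have h6 : (n : ℝ) / 2 ≤ ((2 ^ Nat.log 2 n : ℕ) : ℝ) := by
      have : n < 2 ^ (Nat.log 2 n + 1) := Nat.lt_pow_succ_log_self one_lt_two n
      have : (n : ℝ) < ((2 ^ Nat.log 2 n : ℕ) : ℝ) * 2 := by exact_mod_cast this
      linarith
    have h7 : ((n : ℝ) / 2) ^ c ≤ ((2 ^ Nat.log 2 n : ℕ) : ℝ) ^ c :=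
      Real.rpow_le_rpow (by positivity) h6 hc0.le
    have h8 : (0 : ℝ) ≤ (n : ℝ) ^ (q : ℝ) := by positivity
    exact le_logPlus_div h5 (by linarith) (by linarith)
  have hplus' : ∀ᵐ ω ∂Q, ∀ q : ℚ, ε < δp → q < δp → ∃ᶠ n : ℕ in atTop,
      (q : ℝ) ≤ logPlus (I n ω) / Real.logb 2 n :=
    ae_all_iff.2 fun q => eventually_imp_distrib_left.2 fun h => eventually_imp_distrib_left.2 fun h' => hplus q h h'
  have hminus' : ∀ᵐ ω ∂Q, ∀ q : ℚ, ε < δm → q < δm → ∀ᶠ n : ℕ in atTop,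
      (q : ℝ) ≤ logPlus (I n ω) / Real.logb 2 n :=
    ae_all_iff.2 fun q => eventually_imp_distrib_left.2 fun h => eventually_imp_distrib_left.2 fun h' => hminus q h h'
  filter_upwards [hbdd, hplus', hminus'] with ω hb hp hm
  have hcob := hb.isCoboundedUnder_ge
  constructor
  · rcases le_or_gt δp ε with h | h
    · exact (sub_nonpos.2 h).trans (le_limsup_of_frequently_le
        (Frequently.of_forall fun n => logPlus_div_nonneg _ n) hb)
    · refine (sub_le_self _ hε0).trans (le_of_forall_rat_lt_imp_le fun q hq => ?_)
      exact le_limsup_of_frequently_le (hp q h hq) hb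
  · rcases le_or_gt δm ε with h | h
    · exact (sub_nonpos.2 h).trans (le_liminf_of_le hcob
        (Eventually.of_forall fun n => logPlus_div_nonneg _ n))
    · refine (sub_le_self _ hε0).trans (le_of_forall_rat_lt_imp_le fun q hq => ?_)
      exact le_liminf_of_le hcob (hm q h hq)

end GrowthExponent

section Window

variable {𝕐 : Type*}

/-- The sequences that agree with `ω` on the set of positions `S`. -/
def agreeOn (S : Finset ℤ) (ω : ℤ → 𝕐) : Set (ℤ → 𝕐) := S.restrict ⁻¹' {S.restrict ω}

theorem mem_agreeOn {S : Finset ℤ} {ω ω' : ℤ → 𝕐} :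
    ω' ∈ agreeOn S ω ↔ ∀ j ∈ S, ω' j = ω j := by
  simp [agreeOn, funext_iff]

theorem agreeOn_inter_agreeOn {S T U : Finset ℤ} (h : S ∪ T = U) (ω : ℤ → 𝕐) :
    agreeOn S ω ∩ agreeOn T ω = agreeOn U ω := by
  ext ω'
  simp only [Set.mem_inter_iff, mem_agreeOn, ← h, Finset.mem_union]
  grind

theorem agreeOn_anti {S T : Finset ℤ} (h : S ⊆ T) (ω : ℤ → 𝕐) : agreeOn T ω ⊆ agreeOn S ω :=
  fun _ hω' => mem_agreeOn.2 fun j hj => mem_agreeOn.1 hω' j (h hj)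

theorem iterate_shift_apply (k : ℕ) (ω : ℤ → 𝕐) (i : ℤ) : shift^[k] ω i = ω (i + k) := by
  induction k generalizing ω with
  | zero => simp
  | succ k ih =>
    rw [Function.iterate_succ_apply, ih, shift]
    congr 1
    push_cast
    ring

variable {Q : Measure (ℤ → 𝕏)}

theorem measurableSet_agreeOn [Finite 𝕏] [MeasurableSingletonClass 𝕏] (S : Finset ℤ)
    (ω : ℤ → 𝕏) : MeasurableSet (agreeOn S ω) :=
  (Finset.measurable_restrict S) (measurableSet_singleton _)

theorem forall_mem_Ioc_iff_forall_fin {a b : ℤ} {m : ℕ} (h : a + m = b) {p : ℤ → Prop} :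
    (∀ j ∈ Finset.Ioc a b, p j) ↔ ∀ i : Fin m, p (a + 1 + (i : ℕ)) := by
  constructor
  · intro hp i
    exact hp _ (Finset.mem_Ioc.2 ⟨by lia, by have := i.2; lia⟩)
  · intro hp j hj
    rw [Finset.mem_Ioc] at hj
    have := hp ⟨(j - a - 1).toNat, by lia⟩
    rwa [show a + 1 + (((j - a - 1).toNat : ℕ) : ℤ) = j by lia] at this

theorem measureCode_blockPos (n : ℕ) (ω : ℤ → 𝕏) :
    measureCode Q n (blockPos n ω) = Q.real (agreeOn (Finset.Ioc 0 (n : ℤ)) ω) := by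
  unfold measureCode Measure.real
  congr 2
  ext ω'
  rw [mem_agreeOn, forall_mem_Ioc_iff_forall_fin (zero_add (n : ℤ))]
  simp [blockPos, funext_iff]

theorem measureCode_blockNeg [Finite 𝕏] [MeasurableSingletonClass 𝕏]
    (hQ : MeasurePreserving shift Q Q) (n : ℕ) (ω : ℤ → 𝕏) :
    measureCode Q n (blockNeg n ω) = Q.real (agreeOn (Finset.Ioc (-(n : ℤ)) 0) ω) := by
  rw [measureCode, ← measureReal_def,
    ← (hQ.iterate n).measureReal_preimage (measurableSet_agreeOn _ _).nullMeasurableSet]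
  congr 1
  ext ω'
  rw [Set.mem_preimage, mem_agreeOn, forall_mem_Ioc_iff_forall_fin (neg_add_cancel (n : ℤ))]
  simp only [iterate_shift_apply]
  change blockPos n ω' = blockNeg n ω ↔ _
  rw [funext_iff]
  refine forall_congr' fun i => ?_
  rw [show -(n : ℤ) + 1 + (i : ℕ) + n = 1 + (i : ℕ) by ring]
  rfl

theorem measureCode_blockBoth [Finite 𝕏] [MeasurableSingletonClass 𝕏]
    (hQ : MeasurePreserving shift Q Q) (n : ℕ) (ω : ℤ → 𝕏) :
    measureCode Q (2 * n) (blockBoth n ω) =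
      Q.real (agreeOn (Finset.Ioc (-(n : ℤ)) n) ω) := by
  rw [measureCode, ← measureReal_def,
    ← (hQ.iterate n).measureReal_preimage (measurableSet_agreeOn _ _).nullMeasurableSet]
  congr 1
  ext ω'
  rw [Set.mem_preimage, mem_agreeOn,
    forall_mem_Ioc_iff_forall_fin (m := 2 * n) (by push_cast; ring : -(n : ℤ) + _ = n)]
  simp only [iterate_shift_apply]
  change blockPos (2 * n) ω' = blockBoth n ω ↔ _
  rw [funext_iff]
  refine forall_congr' fun i => ?_
  rw [show -(n : ℤ) + 1 + (i : ℕ) + n = 1 + (i : ℕ) by ring]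
  rfl

theorem pmi_measureCode [Finite 𝕏] [MeasurableSingletonClass 𝕏]
    (hQ : MeasurePreserving shift Q Q) (n : ℕ) (ω : ℤ → 𝕏) :
    pmi (measureCode Q) n ω = -Real.logb 2 (Q.real (agreeOn (Finset.Ioc (-(n : ℤ)) 0) ω))
      - Real.logb 2 (Q.real (agreeOn (Finset.Ioc 0 (n : ℤ)) ω))
      + Real.logb 2 (Q.real (agreeOn (Finset.Ioc (-(n : ℤ)) n) ω)) := by
  rw [pmi, measureCode_blockNeg hQ, measureCode_blockPos, measureCode_blockBoth hQ]

theorem memLp_logb_agreeOn [Finite 𝕏] [MeasurableSingletonClass 𝕏] [IsFiniteMeasure Q]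
    (S : Finset ℤ) (p : ENNReal) :
    MemLp (fun ω => Real.logb 2 (Q.real (agreeOn S ω))) p Q :=
  memLp_comp_of_finite Q (Finset.measurable_restrict S)
    (fun x => Real.logb 2 (Q.real (S.restrict ⁻¹' {x}))) p

theorem integral_logb_agreeOn_sq_le [Fintype 𝕏] [MeasurableSingletonClass 𝕏]
    [IsProbabilityMeasure Q] {S : Finset ℤ} {n : ℕ} (hn : 1 ≤ n) (hS : S.card ≤ 2 * n) :
    ∫ ω, Real.logb 2 (Q.real (agreeOn S ω)) ^ 2 ∂Q ≤
      (16 * Real.log (Fintype.card 𝕏) ^ 2 + 8) / Real.log 2 ^ 2 * (n : ℝ) ^ 2 := by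
  have h := integral_log_fiber_sq_le Q (Finset.measurable_restrict (X := fun _ : ℤ => 𝕏) S)
  have hcard : Real.log (Fintype.card (S → 𝕏)) = S.card * Real.log (Fintype.card 𝕏) := by
    simp [Real.log_pow]
  rw [hcard] at h
  have hS' : (S.card : ℝ) ≤ 2 * n := by exact_mod_cast hS
  have hn' : (1 : ℝ) ≤ n := by exact_mod_cast hn
  have h1 : (S.card : ℝ) ^ 2 ≤ 4 * (n : ℝ) ^ 2 := by
    nlinarith [(Nat.cast_nonneg S.card : (0 : ℝ) ≤ S.card)]
  have h2 : (S.card * Real.log (Fintype.card 𝕏)) ^ 2 ≤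
      4 * (n : ℝ) ^ 2 * Real.log (Fintype.card 𝕏) ^ 2 := by
    rw [mul_pow]; exact mul_le_mul_of_nonneg_right h1 (sq_nonneg _)
  simp only [Real.logb, div_pow, integral_div]
  rw [div_mul_eq_mul_div]
  refine div_le_div_of_nonneg_right (h.trans ?_) (sq_nonneg _)
  nlinarith

theorem memLp_pmi_measureCode [Finite 𝕏] [MeasurableSingletonClass 𝕏] [IsFiniteMeasure Q]
    (hQ : MeasurePreserving shift Q Q) (n : ℕ) (p : ENNReal) :
    MemLp (pmi (measureCode Q) n) p Q := by
  rw [funext (pmi_measureCode hQ n)]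
  exact ((memLp_logb_agreeOn _ p).neg.sub (memLp_logb_agreeOn _ p)).add (memLp_logb_agreeOn _ p)

theorem integral_pmi_measureCode_sq_le [Fintype 𝕏] [MeasurableSingletonClass 𝕏]
    [IsProbabilityMeasure Q] (hQ : MeasurePreserving shift Q Q) {n : ℕ} (hn : 1 ≤ n) :
    ∫ ω, pmi (measureCode Q) n ω ^ 2 ∂Q ≤
      9 * ((16 * Real.log (Fintype.card 𝕏) ^ 2 + 8) / Real.log 2 ^ 2) * (n : ℝ) ^ 2 := by
  have hint : ∀ S : Finset ℤ,
      Integrable (fun ω => Real.logb 2 (Q.real (agreeOn S ω)) ^ 2) Q :=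
    fun S => (memLp_logb_agreeOn S 2).integrable_sq
  have h1 := integral_logb_agreeOn_sq_le (Q := Q) (S := Finset.Ioc (-(n : ℤ)) 0) hn
    (by simp; lia)
  have h2 := integral_logb_agreeOn_sq_le (Q := Q) (S := Finset.Ioc 0 (n : ℤ)) hn
    (by simp; lia)
  have h3 := integral_logb_agreeOn_sq_le (Q := Q) (S := Finset.Ioc (-(n : ℤ)) n) hn
    (by simp; lia)
  have h4 := integral_mono (μ := Q) (memLp_pmi_measureCode hQ n 2).integrable_sq
    ((((hint (Finset.Ioc (-(n : ℤ)) 0)).add (hint (Finset.Ioc 0 (n : ℤ)))).add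
      (hint (Finset.Ioc (-(n : ℤ)) n))).const_mul 3) (fun ω => by
        simp only [Pi.add_apply]
        rw [pmi_measureCode hQ]
        generalize Real.logb 2 _ = a
        generalize Real.logb 2 _ = b
        generalize Real.logb 2 _ = c
        nlinarith [sq_nonneg (a - b), sq_nonneg (a + c), sq_nonneg (b + c)])
  rw [integral_const_mul, integral_add' ((hint _).add (hint _)) (hint _),
    integral_add' (hint _) (hint _)] at h4
  linarith

/-- The pointwise mutual information is almost surely nearly nondecreasing
along dyadic scales. -/
theorem ae_eventually_pmi_dyadic_le [Fintype 𝕏] [MeasurableSingletonClass 𝕏]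
    [IsProbabilityMeasure Q] (hQ : MeasurePreserving shift Q Q) :
    ∀ᵐ ω ∂Q, ∀ᶠ n : ℕ in atTop, pmi (measureCode Q) (2 ^ Nat.log 2 n) ω - 2 * Real.logb 2 n ≤
      pmi (measureCode Q) n ω := by
  have hpos : ∀ᵐ ω ∂Q, ∀ n : ℕ, 0 < Q.real (agreeOn (Finset.Ioc (-(n : ℤ)) n) ω) :=
    ae_all_iff.2 fun n => ae_measureReal_fiber_pos Q _
  set R : ℕ → (ℤ → 𝕏) → ℝ := fun n ω =>
    Q.real (agreeOn (Finset.Ioc (-((2 ^ Nat.log 2 n : ℕ) : ℤ)) 0) ω ∩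
        agreeOn (Finset.Ioc 0 ((2 ^ Nat.log 2 n : ℕ) : ℤ)) ω) *
      (Q.real (agreeOn (Finset.Ioc (-(n : ℤ)) (-((2 ^ Nat.log 2 n : ℕ) : ℤ))) ω ∩
        agreeOn (Finset.Ioc (-((2 ^ Nat.log 2 n : ℕ) : ℤ)) 0) ω) /
        Q.real (agreeOn (Finset.Ioc (-((2 ^ Nat.log 2 n : ℕ) : ℤ)) 0) ω)) *
      (Q.real (agreeOn (Finset.Ioc ((2 ^ Nat.log 2 n : ℕ) : ℤ) n) ω ∩
        agreeOn (Finset.Ioc 0 ((2 ^ Nat.log 2 n : ℕ) : ℤ)) ω) /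
        Q.real (agreeOn (Finset.Ioc 0 ((2 ^ Nat.log 2 n : ℕ) : ℤ)) ω)) /
      Q.real ((agreeOn (Finset.Ioc (-(n : ℤ)) (-((2 ^ Nat.log 2 n : ℕ) : ℤ))) ω ∩
        agreeOn (Finset.Ioc (-((2 ^ Nat.log 2 n : ℕ) : ℤ)) 0) ω) ∩
        (agreeOn (Finset.Ioc ((2 ^ Nat.log 2 n : ℕ) : ℤ) n) ω ∩
        agreeOn (Finset.Ioc 0 ((2 ^ Nat.log 2 n : ℕ) : ℤ)) ω)) with hR
  have hratio : ∀ᵐ ω ∂Q, ∀ᶠ n : ℕ in atTop, ω ∉ {ω | (n : ℝ) ^ 2 ≤ R n ω} := by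
    refine ae_eventually_notMem_of_measureReal_le
      (Real.summable_one_div_nat_pow.2 one_lt_two) ?_
    filter_upwards [eventually_ge_atTop 1] with n hn
    have hn0 : (0 : ℝ) < n := by exact_mod_cast hn
    obtain ⟨hint, hle⟩ := integral_pmi_ratio_le_one Q
      (Finset.measurable_restrict (X := fun _ : ℤ => 𝕏)
        (Finset.Ioc (-(n : ℤ)) (-((2 ^ Nat.log 2 n : ℕ) : ℤ))))
      (Finset.measurable_restrict (X := fun _ : ℤ => 𝕏)
        (Finset.Ioc (-((2 ^ Nat.log 2 n : ℕ) : ℤ)) 0))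
      (Finset.measurable_restrict (X := fun _ : ℤ => 𝕏)
        (Finset.Ioc 0 ((2 ^ Nat.log 2 n : ℕ) : ℤ)))
      (Finset.measurable_restrict (X := fun _ : ℤ => 𝕏)
        (Finset.Ioc ((2 ^ Nat.log 2 n : ℕ) : ℤ) n))
    have h := (mul_meas_ge_le_integral_of_nonneg
      (ae_of_all Q fun ω => (by simp only [hR]; positivity : 0 ≤ R n ω)) hint
      ((n : ℝ) ^ 2)).trans hle
    rw [le_div_iff₀ (by positivity), mul_comm]
    exact h
  filter_upwards [hpos, hratio] with ω hω hr
  filter_upwards [hr, eventually_ge_atTop 1] with n hn h1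
  have hk : 2 ^ Nat.log 2 n ≤ n := Nat.pow_log_le_self 2 (by lia)
  simp only [not_le, hR] at hn
  rw [pmi_measureCode hQ, pmi_measureCode hQ]
  generalize 2 ^ Nat.log 2 n = m at hn hk ⊢
  have hp : ∀ S ⊆ Finset.Ioc (-(n : ℤ)) n, 0 < Q.real (agreeOn S ω) := fun S hS =>
    (hω n).trans_le (measureReal_mono (agreeOn_anti hS ω))
  rw [agreeOn_inter_agreeOn (U := Finset.Ioc (-(m : ℤ)) m) (by ext; simp),
    agreeOn_inter_agreeOn (U := Finset.Ioc (-(n : ℤ)) 0) (by ext; simp; lia),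
    agreeOn_inter_agreeOn (U := Finset.Ioc 0 (n : ℤ)) (by ext; simp; lia),
    agreeOn_inter_agreeOn (U := Finset.Ioc (-(n : ℤ)) n) (by ext; simp)] at hn
  have p1 := hp (Finset.Ioc (-(m : ℤ)) m) (Finset.Ioc_subset_Ioc (by lia) (by lia))
  have p2 := hp (Finset.Ioc (-(n : ℤ)) 0) (Finset.Ioc_subset_Ioc (by lia) (by lia))
  have p3 := hp (Finset.Ioc 0 (n : ℤ)) (Finset.Ioc_subset_Ioc (by lia) (by lia))
  have p4 := hp (Finset.Ioc (-(n : ℤ)) n) (Finset.Ioc_subset_Ioc (by lia) (by lia))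
  have p5 := hp (Finset.Ioc (-(m : ℤ)) 0) (Finset.Ioc_subset_Ioc (by lia) (by lia))
  have p6 := hp (Finset.Ioc 0 (m : ℤ)) (Finset.Ioc_subset_Ioc (by lia) (by lia))
  have hlog := Real.logb_le_logb_of_le one_lt_two (by positivity) hn.le
  rw [Real.logb_div (by positivity) p4.ne', Real.logb_mul (by positivity) (by positivity),
    Real.logb_mul p1.ne' (by positivity), Real.logb_div p2.ne' p5.ne',
    Real.logb_div p3.ne' p6.ne', Real.logb_pow] at hlog
  push_cast at hlog
  linarith

end Window

/-- For a stationary ergodic probability measure `Q` on `𝕏^ℤ` with `𝕏`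
finite and `δ⁻_Q > 0`, `Q`-almost surely `γ⁺_Q ≥ δ⁺_Q - ε_Q` and `γ⁻_Q ≥ δ⁻_Q - ε_Q`. -/
theorem hilberg_random_exponents_lower_bound {𝕏 : Type*} [Fintype 𝕏] [MeasurableSpace 𝕏]
    [MeasurableSingletonClass 𝕏] (Q : Measure (ℤ → 𝕏)) [IsProbabilityMeasure Q]
    (hQ : Ergodic shift Q) (hpos : 0 < deltaMinus Q (measureCode Q)) :
    ∀ᵐ ω ∂Q,
      deltaPlus Q (measureCode Q) - epsilonExp Q (measureCode Q)
          ≤ gammaPlus (measureCode Q) ω ∧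
      deltaMinus Q (measureCode Q) - epsilonExp Q (measureCode Q)
          ≤ gammaMinus (measureCode Q) ω := by
  have h := hQ.toMeasurePreserving
  exact ae_growth_exponents_lower_bound (fun n => memLp_pmi_measureCode h n 2)
    (fun n hn => integral_pmi_measureCode_sq_le h hn) (ae_eventually_pmi_dyadic_le h)
    rfl rfl rfl hpos
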